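/- arXiv:2401.14265 — 11 statements merged into one kernel-verified Lean document; each statement's English description precedes it below -/
import Mathlib

section
/- Fix P > 0 and t ∈ (0,1). The function q : [0,∞) → ℝ defined by q(a) := (t − t²)² · (aP + (aP)² + (aP)² t²) / (1 + aP − aP t²)² is differentiable, its derivative at every a ≥ 0 equals P(1 − t)² t² (1 + aP + 3aP t²) / (1 + aP − aP t²)³, and this derivative is ≥ 0; in particular q is non-decreasing on [0,∞). -/
open Real Set

/-- The per-coordinate variance term
`q(a) = (t-t²)² (aP + (aP)² + (aP)²t²) / (1+aP-aPt²)²`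
is differentiable on `[0,∞)`, its derivative equals
`P(1-t)²t²(1+aP+3aPt²)/(1+aP-aPt²)³`, this derivative is `≥ 0`,
and hence `q` is non-decreasing on `[0,∞)`. -/
theorem q_hasDeriv_and_monotoneOn (P t : ℝ) (hP : 0 < P) (ht : t ∈ Set.Ioo (0 : ℝ) 1) :
    (∀ a ∈ Set.Ici (0 : ℝ),
      HasDerivWithinAt
        (fun a : ℝ =>
          (t - t ^ 2) ^ 2 * (a * P + (a * P) ^ 2 + (a * P) ^ 2 * t ^ 2) /
            (1 + a * P - a * P * t ^ 2) ^ 2)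
        (P * (1 - t) ^ 2 * t ^ 2 * (1 + a * P + 3 * (a * P) * t ^ 2) /
          (1 + a * P - a * P * t ^ 2) ^ 3)
        (Set.Ici 0) a
      ∧ 0 ≤ P * (1 - t) ^ 2 * t ^ 2 * (1 + a * P + 3 * (a * P) * t ^ 2) /
          (1 + a * P - a * P * t ^ 2) ^ 3)
    ∧ MonotoneOn
        (fun a : ℝ =>
          (t - t ^ 2) ^ 2 * (a * P + (a * P) ^ 2 + (a * P) ^ 2 * t ^ 2) /
            (1 + a * P - a * P * t ^ 2) ^ 2)
        (Set.Ici 0) := by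
  obtain ⟨ht0, ht1⟩ := ht
  have hs : 0 < 1 - t ^ 2 := by nlinarith
  have hD : ∀ a : ℝ, 0 ≤ a → 0 < 1 + a * P - a * P * t ^ 2 := by
    intro a ha
    have h : 0 ≤ a * P * (1 - t ^ 2) := by positivity
    linarith
  have key : ∀ a ∈ Set.Ici (0 : ℝ),
      HasDerivWithinAt
        (fun a : ℝ =>
          (t - t ^ 2) ^ 2 * (a * P + (a * P) ^ 2 + (a * P) ^ 2 * t ^ 2) /
            (1 + a * P - a * P * t ^ 2) ^ 2)
        (P * (1 - t) ^ 2 * t ^ 2 * (1 + a * P + 3 * (a * P) * t ^ 2) /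
          (1 + a * P - a * P * t ^ 2) ^ 3)
        (Set.Ici 0) a
      ∧ 0 ≤ P * (1 - t) ^ 2 * t ^ 2 * (1 + a * P + 3 * (a * P) * t ^ 2) /
          (1 + a * P - a * P * t ^ 2) ^ 3 := by
    intro a ha
    have ha0 : 0 ≤ a := ha
    have hDa := hD a ha0
    refine ⟨?_, by positivity⟩
    apply HasDerivAt.hasDerivWithinAt
    have h1 : HasDerivAt (fun a : ℝ => a * P) P a := by
      simpa using (hasDerivAt_id a).mul_const P
    have h2 : HasDerivAt (fun a : ℝ => (a * P) ^ 2) (2 * (a * P) * P) a := by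
      simpa using h1.fun_pow 2
    have hN := ((h1.fun_add h2).fun_add (h2.mul_const (t ^ 2))).const_mul ((t - t ^ 2) ^ 2)
    have hE := ((h1.const_add 1).fun_sub (h1.mul_const (t ^ 2))).fun_pow 2
    have hne : (1 + a * P - a * P * t ^ 2) ^ 2 ≠ 0 := by positivity
    refine (hN.fun_div hE hne).congr_deriv ?_
    rw [div_eq_div_iff (by positivity) (by positivity)]
    push_cast
    ring
  refine ⟨key, ?_⟩
  refine monotoneOn_of_hasDerivWithinAt_nonneg (convex_Ici 0)
    (fun a ha => (key a ha).1.continuousWithinAt)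
    (fun a ha => (key a (interior_subset ha)).1.mono interior_subset)
    (fun a ha => (key a (interior_subset ha)).2)
end

section
/- Fix P > 0, t ∈ (0,1), L ∈ ℝ, and n ≥ 1. Let a = (a_1,…,a_n) and a' = (a'_1,…,a'_n) be vectors of nonnegative reals with a'_i ≤ a_i for all i, and with a'_j > 0 for some j. Then exp(tL − E(a,t)) · ((t − t²)² F(a,t))^(−1/2) ≤ exp(tL − E(a',t)) · ((t − t²)² F(a',t))^(−1/2). -/
open Real Set Finset

/-- `E(a,t) = (1/2) ∑ᵢ [ t log(1 + aᵢP) + log(1 - aᵢP t²/(1 + aᵢP)) ]`. -/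
noncomputable def E (P : ℝ) {n : ℕ} (a : Fin n → ℝ) (t : ℝ) : ℝ :=
  (1/2) * ∑ i, (t * Real.log (1 + a i * P) + Real.log (1 - a i * P * t ^ 2 / (1 + a i * P)))

/-- `F(a,t) = ∑ᵢ (aᵢP + (aᵢP)² + (aᵢP)²t²) / (1 + aᵢP - aᵢP t²)²`. -/
noncomputable def F (P : ℝ) {n : ℕ} (a : Fin n → ℝ) (t : ℝ) : ℝ :=
  ∑ i, (a i * P + (a i * P) ^ 2 + (a i * P) ^ 2 * t ^ 2) / (1 + a i * P - a i * P * t ^ 2) ^ 2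

lemma aux_F (x y t : ℝ) (hx : 0 ≤ x) (hxy : x ≤ y) (h0 : 0 < t) (h1 : t < 1) :
    (x + x ^ 2 + x ^ 2 * t ^ 2) / (1 + x - x * t ^ 2) ^ 2 ≤
      (y + y ^ 2 + y ^ 2 * t ^ 2) / (1 + y - y * t ^ 2) ^ 2 := by
  have hs : 0 < 1 - t ^ 2 := by nlinarith
  have hy : 0 ≤ y := hx.trans hxy
  have dx : 0 < 1 + x - x * t ^ 2 := by nlinarith [mul_nonneg hx hs.le]
  have dy : 0 < 1 + y - y * t ^ 2 := by nlinarith [mul_nonneg hy hs.le]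
  rw [div_le_div_iff₀ (by positivity) (by positivity)]
  have k : 0 ≤ (y - x) * (1 + (1 + t ^ 2) * (x + y) +
      (1 - t ^ 2) * (1 + 3 * t ^ 2) * (x * y)) := by
    have := sub_nonneg.2 hxy
    positivity
  nlinarith [k]

lemma aux_E (x y t : ℝ) (hx : 0 ≤ x) (hxy : x ≤ y) (h0 : 0 < t) (h1 : t < 1) :
    t * Real.log (1 + x) + Real.log (1 - x * t ^ 2 / (1 + x)) ≤
      t * Real.log (1 + y) + Real.log (1 - y * t ^ 2 / (1 + y)) := by
  have hs : 0 < 1 - t ^ 2 := by nlinarith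
  have hy : 0 ≤ y := hx.trans hxy
  have e : ∀ z : ℝ, 0 ≤ z → t * Real.log (1 + z) + Real.log (1 - z * t ^ 2 / (1 + z)) =
      Real.log (1 + (1 - t ^ 2) * z) - (1 - t) * Real.log (1 + z) := by
    intro z hz
    have h : 1 - z * t ^ 2 / (1 + z) = (1 + (1 - t ^ 2) * z) / (1 + z) := by
      field_simp
      ring
    rw [h, Real.log_div (by positivity) (by positivity)]
    ring
  rw [e x hx, e y hy]
  have hd : 0 ≤ y - x := sub_nonneg.2 hxy
  have b := rpow_one_add_le_one_add_mul_self (s := (y - x) / (1 + x)) (p := 1 - t)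
    (by have : 0 ≤ (y - x) / (1 + x) := by positivity
        linarith) (by linarith) (by linarith)
  have r1 : 1 + (y - x) / (1 + x) = (1 + y) / (1 + x) := by
    field_simp
    ring
  have b2 : 1 + (1 - t) * ((y - x) / (1 + x)) ≤
      (1 + (1 - t ^ 2) * y) / (1 + (1 - t ^ 2) * x) := by
    have : (1 + (1 - t ^ 2) * y) / (1 + (1 - t ^ 2) * x) -
      (1 + (1 - t) * ((y - x) / (1 + x))) =
      (y - x) * ((1 - t) * (t + (t + t ^ 2) * x)) / ((1 + (1 - t ^ 2) * x) * (1 + x)) := by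
      have : 1 + (1 - t ^ 2) * x ≠ 0 := by positivity
      field_simp
      ring
    have h3 : 0 ≤ (y - x) * ((1 - t) * (t + (t + t ^ 2) * x)) /
        ((1 + (1 - t ^ 2) * x) * (1 + x)) := by
      have : 0 ≤ 1 - t := by linarith
      positivity
    linarith
  rw [r1] at b
  have l := Real.log_le_log (by positivity) (b.trans b2)
  rw [Real.log_rpow (by positivity), Real.log_div (by positivity) (by positivity),
    Real.log_div (by positivity) (by positivity)] at l
  linarith

/-- **Remark 2.** The saddlepoint bound `g₁(a,t) g₂(a,t)` with
`g₁(a,t) = exp(tL - E(a,t))` and `g₂(a,t) = ((t-t²)² F(a,t))^(-1/2)` is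
non-increasing in each coordinate `aᵢ`. -/
theorem saddlepoint_bound_antitone_in_a
    (P L t : ℝ) (hP : 0 < P) (ht : t ∈ Set.Ioo (0 : ℝ) 1)
    (n : ℕ) (hn : 1 ≤ n) (a a' : Fin n → ℝ)
    (ha' : ∀ i, 0 ≤ a' i) (hle : ∀ i, a' i ≤ a i) (hj : ∃ j, 0 < a' j) :
    Real.exp (t * L - E P a t) * ((t - t ^ 2) ^ 2 * F P a t) ^ (-(1/2) : ℝ) ≤
      Real.exp (t * L - E P a' t) * ((t - t ^ 2) ^ 2 * F P a' t) ^ (-(1/2) : ℝ) := by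
  obtain ⟨h0, h1⟩ := ht
  have hx : ∀ i, 0 ≤ a' i * P := fun i => mul_nonneg (ha' i) hP.le
  have hxy : ∀ i, a' i * P ≤ a i * P := fun i => mul_le_mul_of_nonneg_right (hle i) hP.le
  have hE : E P a' t ≤ E P a t := by
    unfold E
    exact mul_le_mul_of_nonneg_left
      (Finset.sum_le_sum fun i _ => aux_E _ _ t (hx i) (hxy i) h0 h1) (by norm_num)
  have hF : F P a' t ≤ F P a t := by
    unfold F
    exact Finset.sum_le_sum fun i _ => aux_F _ _ t (hx i) (hxy i) h0 h1
  have hF0 : 0 < F P a' t := by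
    unfold F
    obtain ⟨j, hj⟩ := hj
    refine Finset.sum_pos' (fun i _ => ?_) ⟨j, Finset.mem_univ j, ?_⟩
    · have := hx i
      positivity
    · have h2 : 0 < a' j * P := mul_pos hj hP
      have h3 : 0 < 1 + a' j * P - a' j * P * t ^ 2 := by
        have : 0 < 1 - t ^ 2 := by nlinarith
        nlinarith [mul_pos h2 this]
      positivity
  have ht2 : 0 < t - t ^ 2 := by nlinarith
  refine mul_le_mul (Real.exp_le_exp.2 (by linarith)) ?_ ?_ (Real.exp_pos _).le
  · exact Real.rpow_le_rpow_of_nonpos (by positivity)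
      (mul_le_mul_of_nonneg_left hF (by positivity)) (by norm_num)
  · have : 0 < F P a t := hF0.trans_le hF
    positivity
end

section
/- Fix P > 0 and a ≥ 0. The function t ↦ −(1/2)·[ t·log(1 + aP) + log(1 − aP t²/(1 + aP)) ] is twice differentiable on (0,1), its second derivative at every t ∈ (0,1) equals (aP + (aP)² + (aP)² t²) / (1 + aP − aP t²)², and this second derivative is ≥ 0. Consequently, for every L ∈ ℝ, every n ≥ 1, and every vector a = (a_1,…,a_n) of nonnegative reals, the function t ↦ tL − E(a,t) is convex on (0,1). -/
open Real Set Finset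

lemma aux_deriv (P a : ℝ) (hP : 0 < P) (ha : 0 ≤ a) (t : ℝ) (ht : t ∈ Set.Ioo (0 : ℝ) 1) :
      HasDerivAt
        (fun s : ℝ =>
          -(1/2) * (s * Real.log (1 + a * P) + Real.log (1 - a * P * s ^ 2 / (1 + a * P))))
        (-(1/2) * Real.log (1 + a * P) + a * P * t / (1 + a * P - a * P * t ^ 2)) t
      ∧ HasDerivAt (fun t : ℝ => -(1/2) * Real.log (1 + a * P) +
            a * P * t / (1 + a * P - a * P * t ^ 2))
          ((a * P + (a * P) ^ 2 + (a * P) ^ 2 * t ^ 2) / (1 + a * P - a * P * t ^ 2) ^ 2) t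
      ∧ 0 ≤ (a * P + (a * P) ^ 2 + (a * P) ^ 2 * t ^ 2) / (1 + a * P - a * P * t ^ 2) ^ 2 := by
  obtain ⟨h0, h1⟩ := ht
  have hx : 0 ≤ a * P := by positivity
  generalize a * P = x at *
  have ht2 : t ^ 2 ≤ 1 := by nlinarith
  have hd : 0 < 1 + x - x * t ^ 2 := by nlinarith
  have hx1 : 0 < 1 + x := by linarith
  have he : 1 - x * t ^ 2 / (1 + x) = (1 + x - x * t ^ 2) / (1 + x) := by field_simp
  have hne : 1 - x * t ^ 2 / (1 + x) ≠ 0 := by rw [he]; positivity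
  have hsq : HasDerivAt (fun s : ℝ => s ^ 2) (2 * t) t := by
    simpa using hasDerivAt_pow 2 t
  refine ⟨?_, ?_, by positivity⟩
  · have h := ((((hasDerivAt_id t).mul_const (Real.log (1 + x))).add
      ((((hsq.const_mul x).div_const (1 + x)).const_sub 1).log hne)).const_mul (-(1/2)))
    refine h.congr_deriv ?_
    rw [he]
    have := hd.ne'
    field_simp
    ring
  · have h := (((hasDerivAt_id t).const_mul x).div
      ((hsq.const_mul x).const_sub (1 + x)) hd.ne').const_add (-(1/2) * Real.log (1 + x))
    refine h.congr_deriv ?_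
    congr 1
    simp only [id]
    ring

lemma aux_convex (P a : ℝ) (hP : 0 < P) (ha : 0 ≤ a) :
    ConvexOn ℝ (Set.Ioo (0 : ℝ) 1) (fun s : ℝ =>
      -(1/2) * (s * Real.log (1 + a * P) + Real.log (1 - a * P * s ^ 2 / (1 + a * P)))) := by
  refine convexOn_of_hasDerivWithinAt2_nonneg (convex_Ioo 0 1)
    (fun t ht => (aux_deriv P a hP ha t ht).1.continuousAt.continuousWithinAt)
    (fun t ht => (aux_deriv P a hP ha t (interior_subset ht)).1.hasDerivWithinAt)
    (fun t ht => (aux_deriv P a hP ha t (interior_subset ht)).2.1.hasDerivWithinAt)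
    (fun t ht => (aux_deriv P a hP ha t (interior_subset ht)).2.2)

/-- The per-coordinate exponent `t ↦ -(1/2)(t log(1+aP) + log(1-aPt²/(1+aP)))` is twice
differentiable on `(0,1)`, with second derivative `(aP + (aP)² + (aP)²t²)/(1+aP-aPt²)² ≥ 0`;
consequently `t ↦ tL - E(a,t)` is convex on `(0,1)`. -/
theorem second_derivative_and_convexity (P a : ℝ) (hP : 0 < P) (ha : 0 ≤ a) :
    (∃ ψ' : ℝ → ℝ, ∀ t ∈ Set.Ioo (0 : ℝ) 1,
      HasDerivAt
        (fun s : ℝ =>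
          -(1/2) * (s * Real.log (1 + a * P) + Real.log (1 - a * P * s ^ 2 / (1 + a * P))))
        (ψ' t) t
      ∧ HasDerivAt ψ'
          ((a * P + (a * P) ^ 2 + (a * P) ^ 2 * t ^ 2) / (1 + a * P - a * P * t ^ 2) ^ 2) t
      ∧ 0 ≤ (a * P + (a * P) ^ 2 + (a * P) ^ 2 * t ^ 2) / (1 + a * P - a * P * t ^ 2) ^ 2)
    ∧ ∀ (L : ℝ) (n : ℕ), 1 ≤ n → ∀ b : Fin n → ℝ, (∀ i, 0 ≤ b i) →
        ConvexOn ℝ (Set.Ioo (0 : ℝ) 1) (fun t => t * L - E P b t) := by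
  refine ⟨⟨_, fun t ht => aux_deriv P a hP ha t ht⟩, ?_⟩
  intro L n _ b hb
  refine ⟨convex_Ioo 0 1, ?_⟩
  intro x hx y hy p q hp hq hpq
  have h := Finset.sum_le_sum (s := Finset.univ)
    (fun i _ => (aux_convex P (b i) hP (hb i)).2 hx hy hp hq hpq)
  simp only [smul_eq_mul, Finset.sum_add_distrib, ← Finset.mul_sum] at h
  simp only [smul_eq_mul, E, Finset.sum_add_distrib, ← Finset.mul_sum]
  linarith
end

section
/- Fix P > 0, L ∈ ℝ, n ≥ 1, and a vector a = (a_1,…,a_n) of nonnegative reals. If t₀ ∈ (0,1) satisfies ∑_{i=1}^n [ (1/2)·log(1 + a_i P) − a_i P t₀ / (1 + a_i P − a_i P t₀²) ] = L, then for every t ∈ (0,1) one has t₀·L − E(a,t₀) ≤ t·L − E(a,t). -/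
open Real Set Finset

theorem saddle_term (c s t : ℝ) (hc : 0 ≤ c) (hs : s ∈ Set.Ioo (0 : ℝ) 1)
    (ht : t ∈ Set.Ioo (0 : ℝ) 1) :
    Real.log (1 - c * t ^ 2 / (1 + c)) - Real.log (1 - c * s ^ 2 / (1 + c))
      ≤ 2 * (s - t) * (c * s / (1 + c - c * s ^ 2)) := by
  have h1 : 0 < 1 + c := by linarith
  have key : ∀ x ∈ Set.Ioo (0 : ℝ) 1, 0 < 1 + c - c * x ^ 2 := by
    intro x hx
    have : x ^ 2 ≤ 1 := by nlinarith [hx.1, hx.2]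
    nlinarith
  have e : ∀ x : ℝ, 1 - c * x ^ 2 / (1 + c) = (1 + c - c * x ^ 2) / (1 + c) := by
    intro x; field_simp
  have hS := key s hs
  have hT := key t ht
  rw [e, e, Real.log_div hT.ne' h1.ne', Real.log_div hS.ne' h1.ne']
  have h2 := Real.log_le_sub_one_of_pos (div_pos hT hS)
  rw [Real.log_div hT.ne' hS.ne'] at h2
  have h3 : (1 + c - c * t ^ 2) / (1 + c - c * s ^ 2) - 1
      ≤ 2 * (s - t) * (c * s / (1 + c - c * s ^ 2)) := by
    rw [div_sub_one hS.ne', ← mul_div_assoc]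
    apply div_le_div_of_nonneg_right _ hS.le
    nlinarith [mul_nonneg hc (sq_nonneg (s - t))]
  linarith

/-- **Saddlepoint condition.** If `t₀ ∈ (0,1)` is a stationary point of `t ↦ tL - E(a,t)`,
i.e. `∑ᵢ [ (1/2) log(1+aᵢP) - aᵢP t₀/(1+aᵢP-aᵢP t₀²) ] = L`, then
`t₀ L - E(a,t₀) ≤ t L - E(a,t)` for every `t ∈ (0,1)`. -/
theorem saddlepoint_is_min
    (P L : ℝ) (hP : 0 < P) (n : ℕ) (hn : 1 ≤ n) (a : Fin n → ℝ) (ha : ∀ i, 0 ≤ a i)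
    (t₀ : ℝ) (ht₀ : t₀ ∈ Set.Ioo (0 : ℝ) 1)
    (hstat : ∑ i, ((1/2) * Real.log (1 + a i * P) -
        a i * P * t₀ / (1 + a i * P - a i * P * t₀ ^ 2)) = L) :
    ∀ t ∈ Set.Ioo (0 : ℝ) 1, t₀ * L - E P a t₀ ≤ t * L - E P a t := by
  intro t ht
  subst hstat
  unfold E
  rw [Finset.mul_sum, Finset.mul_sum, Finset.mul_sum, Finset.mul_sum,
    ← Finset.sum_sub_distrib, ← Finset.sum_sub_distrib]
  apply Finset.sum_le_sum
  intro i _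
  have h := saddle_term (a i * P) t₀ t (mul_nonneg (ha i) hP.le) ht₀ ht
  linarith
end

section
/- Fix P > 0, n ≥ 1, and a vector a = (a_1,…,a_n) of nonnegative reals. The function t ↦ F(a,t) is differentiable on (0,1), its derivative at every t ∈ (0,1) equals ∑_{i=1}^n 2(a_i P)² t (3 + 3 a_i P + a_i P t²) / (1 + a_i P − a_i P t²)³, and this derivative is ≥ 0; in particular F(a,·) is non-decreasing on (0,1). -/
open Real Set Finset

lemma D_pos {x t : ℝ} (hx : 0 ≤ x) (ht : t ∈ Set.Ioo (0 : ℝ) 1) : 0 < 1 + x - x * t ^ 2 := by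
  have h2 : t ^ 2 ≤ 1 := by nlinarith [ht.1, ht.2]
  nlinarith [mul_nonneg hx (sub_nonneg.2 h2)]

lemma term_deriv {x t : ℝ} (hx : 0 ≤ x) (ht : t ∈ Set.Ioo (0 : ℝ) 1) :
    HasDerivAt (fun s : ℝ => (x + x ^ 2 + x ^ 2 * s ^ 2) / (1 + x - x * s ^ 2) ^ 2)
      (2 * x ^ 2 * t * (3 + 3 * x + x * t ^ 2) / (1 + x - x * t ^ 2) ^ 3) t := by
  have hD := (D_pos hx ht).ne'
  have hs : HasDerivAt (fun s : ℝ => s ^ 2) (2 * t) t := by simpa using hasDerivAt_pow 2 t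
  have hN := (hs.const_mul (x ^ 2)).const_add (x + x ^ 2)
  have hE := ((hs.const_mul x).const_sub (1 + x)).fun_pow 2
  refine (hN.fun_div hE (pow_ne_zero 2 hD)).congr_deriv ?_
  rw [div_eq_div_iff (pow_ne_zero 2 (pow_ne_zero 2 hD)) (pow_ne_zero 3 hD)]
  push_cast
  ring

/-- `F(a,·) = -E_t⁽²⁾(a,·)` is differentiable on `(0,1)` with derivative
`∑ᵢ 2(aᵢP)²t(3+3aᵢP+aᵢP t²)/(1+aᵢP-aᵢP t²)³ ≥ 0`; hence it is non-decreasing on `(0,1)`. -/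
theorem F_hasDeriv_and_monotoneOn
    (P : ℝ) (hP : 0 < P) (n : ℕ) (hn : 1 ≤ n) (a : Fin n → ℝ) (ha : ∀ i, 0 ≤ a i) :
    (∀ t ∈ Set.Ioo (0 : ℝ) 1,
      HasDerivWithinAt (fun s => F P a s)
        (∑ i, 2 * (a i * P) ^ 2 * t * (3 + 3 * (a i * P) + a i * P * t ^ 2) /
          (1 + a i * P - a i * P * t ^ 2) ^ 3)
        (Set.Ioo 0 1) t
      ∧ 0 ≤ ∑ i, 2 * (a i * P) ^ 2 * t * (3 + 3 * (a i * P) + a i * P * t ^ 2) /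
          (1 + a i * P - a i * P * t ^ 2) ^ 3)
    ∧ MonotoneOn (fun s => F P a s) (Set.Ioo 0 1) := by
  have hx : ∀ i, 0 ≤ a i * P := fun i => mul_nonneg (ha i) hP.le
  have hd : ∀ t ∈ Set.Ioo (0 : ℝ) 1, HasDerivAt (fun s => F P a s)
        (∑ i, 2 * (a i * P) ^ 2 * t * (3 + 3 * (a i * P) + a i * P * t ^ 2) /
          (1 + a i * P - a i * P * t ^ 2) ^ 3) t := by
    intro t ht
    unfold F
    exact HasDerivAt.fun_sum fun i _ => term_deriv (hx i) ht
  have h0 : ∀ t ∈ Set.Ioo (0 : ℝ) 1,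
      0 ≤ ∑ i, 2 * (a i * P) ^ 2 * t * (3 + 3 * (a i * P) + a i * P * t ^ 2) /
          (1 + a i * P - a i * P * t ^ 2) ^ 3 := by
    intro t ht
    refine Finset.sum_nonneg fun i _ => ?_
    have h1 := D_pos (hx i) ht
    have h2 := hx i
    have h3 := ht.1
    refine div_nonneg (mul_nonneg (by positivity) ?_) (pow_nonneg h1.le 3)
    have := mul_nonneg h2 (sq_nonneg t)
    linarith
  refine ⟨fun t ht => ⟨(hd t ht).hasDerivWithinAt, h0 t ht⟩, ?_⟩
  refine monotoneOn_of_deriv_nonneg (convex_Ioo 0 1)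
    (fun t ht => (hd t ht).continuousAt.continuousWithinAt) ?_ ?_
  · rw [interior_Ioo]
    exact fun t ht => (hd t ht).differentiableAt.differentiableWithinAt
  · rw [interior_Ioo]
    intro t ht
    rw [(hd t ht).deriv]
    exact h0 t ht
end

section
/- For every β > 0 and c > 0, ∫_{ℝ} exp(−β ρ²/2) · c/(c² + ρ²) dρ = 2π · exp(c² β / 2) · Q(c·√β). -/
open Real Set MeasureTheory

/-- The Gaussian Q-function `Q(x) = ∫_x^∞ (1/√(2π)) exp(-u²/2) du`. -/
noncomputable def gaussianQ (x : ℝ) : ℝ :=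
  ∫ u in Set.Ioi x, (1 / Real.sqrt (2 * Real.pi)) * Real.exp (-u ^ 2 / 2)

theorem aux_inner_s (a b : ℝ) (ha : 0 < a) (hb : 0 < b) :
    ∫ s in Set.Ioi b, s * Real.exp (-s ^ 2 * a / 2) = Real.exp (-b ^ 2 * a / 2) / a := by
  have hd : ∀ x ∈ Set.Ici b, HasDerivAt (fun s : ℝ => -(Real.exp (-s ^ 2 * a / 2) / a))
      (x * Real.exp (-x ^ 2 * a / 2)) x := by
    intro x _
    have h1 : HasDerivAt (fun s : ℝ => -s ^ 2 * a / 2) (-(2 * x) * a / 2) x := by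
      have := (((hasDerivAt_pow 2 x).neg).mul_const a).div_const 2
      simpa using this
    have h2 := (h1.exp.div_const a).neg
    have h5 : x * Real.exp (-x ^ 2 * a / 2) =
        -(Real.exp (-x ^ 2 * a / 2) * (-(2 * x) * a / 2) / a) := by
      field_simp
    rw [h5]
    exact h2
  have ht : Filter.Tendsto (fun s : ℝ => -(Real.exp (-s ^ 2 * a / 2) / a)) Filter.atTop
      (nhds (-(0 / a))) := by
    refine Filter.Tendsto.neg (Filter.Tendsto.div_const ?_ a)
    refine Real.tendsto_exp_atBot.comp ?_
    have h3 : Filter.Tendsto (fun s : ℝ => (a / 2) * s ^ 2) Filter.atTop Filter.atTop :=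
      (Filter.tendsto_pow_atTop (by norm_num)).const_mul_atTop (by positivity)
    have h4 := Filter.tendsto_neg_atTop_atBot.comp h3
    refine h4.congr (fun s => ?_)
    simp only [Function.comp]
    ring
  have := integral_Ioi_of_hasDerivAt_of_nonneg' hd
    (fun x hx => mul_nonneg (hb.trans hx).le (Real.exp_pos _).le) ht
  rw [this]
  ring

theorem aux_inner_r (c s : ℝ) (hs : 0 < s) :
    ∫ ρ : ℝ, s * Real.exp (-s ^ 2 * (c ^ 2 + ρ ^ 2) / 2) =
      Real.sqrt (2 * Real.pi) * Real.exp (-(c * s) ^ 2 / 2) := by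
  have h : ∀ ρ : ℝ, s * Real.exp (-s ^ 2 * (c ^ 2 + ρ ^ 2) / 2) =
      (s * Real.exp (-(c * s) ^ 2 / 2)) * Real.exp (-(s ^ 2 / 2) * ρ ^ 2) := by
    intro ρ
    rw [mul_assoc, ← Real.exp_add]
    congr 2
    ring
  simp_rw [h]
  rw [integral_const_mul, integral_gaussian]
  have : Real.pi / (s ^ 2 / 2) = 2 * Real.pi / s ^ 2 := by field_simp
  rw [this, Real.sqrt_div (by positivity), Real.sqrt_sq hs.le]
  field_simp

theorem aux_int (b c : ℝ) (hb : 0 < b) (hc : 0 < c) :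
    Integrable (Function.uncurry fun (s ρ : ℝ) => s * Real.exp (-s ^ 2 * (c ^ 2 + ρ ^ 2) / 2))
      ((volume.restrict (Set.Ioi b)).prod volume) := by
  rw [integrable_prod_iff (by
    apply Continuous.aestronglyMeasurable
    unfold Function.uncurry
    fun_prop)]
  constructor
  · filter_upwards [ae_restrict_mem measurableSet_Ioi] with s hs
    have hs' : 0 < s := hb.trans hs
    have := (integrable_exp_neg_mul_sq (b := s ^ 2 / 2) (by positivity)).const_mul
      (s * Real.exp (-(c * s) ^ 2 / 2))
    refine this.congr (Filter.Eventually.of_forall fun ρ => ?_)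
    simp only [Function.uncurry]
    rw [mul_assoc, ← Real.exp_add]
    congr 2
    ring
  · have h1 : Integrable (fun s : ℝ => Real.sqrt (2 * Real.pi) * Real.exp (-(c * s) ^ 2 / 2))
        (volume.restrict (Set.Ioi b)) := by
      have := ((integrable_exp_neg_mul_sq (b := c ^ 2 / 2) (by positivity)).const_mul
        (Real.sqrt (2 * Real.pi))).restrict (s := Set.Ioi b)
      refine this.congr (Filter.Eventually.of_forall fun s => ?_)
      simp only
      congr 2
      ring
    refine h1.congr ?_
    filter_upwards [ae_restrict_mem measurableSet_Ioi] with s hs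
    have hs' : 0 < s := hb.trans hs
    rw [← aux_inner_r c s hs']
    refine integral_congr_ae (Filter.Eventually.of_forall fun ρ => ?_)
    simp only [Function.uncurry]
    rw [Real.norm_of_nonneg (by positivity)]

/-- **Gaussian-weighted Cauchy-kernel (Voigt) integral identity.** For `β > 0` and `c > 0`,
`∫ exp(-βρ²/2) c/(c²+ρ²) dρ = 2π exp(c²β/2) Q(c√β)`. -/
theorem gaussian_cauchy_integral (β c : ℝ) (hβ : 0 < β) (hc : 0 < c) :
    ∫ ρ : ℝ, Real.exp (-β * ρ ^ 2 / 2) * (c / (c ^ 2 + ρ ^ 2)) =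
      2 * Real.pi * Real.exp (c ^ 2 * β / 2) * gaussianQ (c * Real.sqrt β) := by
  have hb : 0 < Real.sqrt β := Real.sqrt_pos.mpr hβ
  have hb2 : Real.sqrt β ^ 2 = β := Real.sq_sqrt hβ.le
  have h1 : ∀ ρ : ℝ, Real.exp (-β * ρ ^ 2 / 2) * (c / (c ^ 2 + ρ ^ 2)) =
      (c * Real.exp (c ^ 2 * β / 2)) *
        ∫ s in Set.Ioi (Real.sqrt β), s * Real.exp (-s ^ 2 * (c ^ 2 + ρ ^ 2) / 2) := by
    intro ρ
    rw [aux_inner_s _ _ (by positivity) hb, hb2]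
    have : Real.exp (-β * ρ ^ 2 / 2) =
        Real.exp (c ^ 2 * β / 2) * Real.exp (-β * (c ^ 2 + ρ ^ 2) / 2) := by
      rw [← Real.exp_add]
      congr 1
      ring
    rw [this]
    ring
  simp_rw [h1]
  rw [integral_const_mul, ← integral_integral_swap (aux_int _ c hb hc),
    setIntegral_congr_fun measurableSet_Ioi
      (fun s hs => aux_inner_r c s (hb.trans hs)), integral_const_mul,
    integral_comp_mul_left_Ioi (fun u => Real.exp (-u ^ 2 / 2)) _ hc]
  unfold gaussianQ
  rw [integral_const_mul, smul_eq_mul]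
  have h2 : Real.sqrt (2 * Real.pi) ^ 2 = 2 * Real.pi := Real.sq_sqrt (by positivity)
  have h3 : 0 < Real.sqrt (2 * Real.pi) := Real.sqrt_pos.mpr (by positivity)
  generalize (∫ u in Set.Ioi (c * Real.sqrt β), Real.exp (-u ^ 2 / 2)) = I
  rw [← h2]
  generalize Real.sqrt (2 * Real.pi) = q at *
  rw [Real.sqrt_sq h3.le]
  field_simp
end

section
/- For every β > 0 and c > 0, the complex-valued integral ∫_{ℝ} exp(−β ρ²/2) / (c + iρ) dρ equals the real number 2π · exp(c² β / 2) · Q(c·√β), where i is the imaginary unit. -/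
open Real Set MeasureTheory Complex

lemma gcc_real (s c : ℝ) (hs : 0 < s) :
    ∫ t in Set.Ioi (0:ℝ), Real.exp (-c * t - t ^ 2 / (2 * s ^ 2)) =
      s * (Real.exp (c ^ 2 * s ^ 2 / 2) * ∫ u in Set.Ioi (c * s), Real.exp (-u ^ 2 / 2)) := by
  have h1 := integral_comp_mul_left_Ioi
    (fun t : ℝ => Real.exp (-c * t - t ^ 2 / (2 * s ^ 2))) 0 hs
  have h2 := (measurePreserving_add_right volume (c * s)).setIntegral_preimage_emb
    (measurableEmbedding_addRight (c * s)) (fun u : ℝ => Real.exp (-u ^ 2 / 2)) (Set.Ioi (c * s))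
  have h3 : (fun x : ℝ => x + c * s) ⁻¹' (Set.Ioi (c * s)) = Set.Ioi 0 := by
    ext x; simp
  rw [h3] at h2
  rw [mul_zero, smul_eq_mul] at h1
  rw [← h2, ← integral_const_mul]
  have h4 : ∀ x : ℝ, Real.exp (c ^ 2 * s ^ 2 / 2) * Real.exp (-(x + c * s) ^ 2 / 2)
      = Real.exp (-c * (s * x) - (s * x) ^ 2 / (2 * s ^ 2)) := by
    intro x
    rw [← Real.exp_add]
    congr 1
    field_simp
    ring
  simp_rw [h4]
  rw [h1]
  field_simp

lemma gcc_inner (β c : ℝ) (hβ : 0 < β) (t : ℝ) :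
    ∫ ρ : ℝ, (Real.exp (-β * ρ ^ 2 / 2) : ℂ) * Complex.exp (-((c : ℂ) + ρ * Complex.I) * t) =
      ((Real.sqrt (2 * Real.pi / β) * Real.exp (-c * t - t ^ 2 / (2 * β)) : ℝ) : ℂ) := by
  have h := fourierIntegral_gaussian (b := (β / 2 : ℂ)) (by
    have : (β / 2 : ℂ) = ((β / 2 : ℝ) : ℂ) := by push_cast; rfl
    rw [this, ofReal_re]; positivity) (-t : ℂ)
  have h5 : ((Real.pi : ℂ) / (β / 2 : ℂ)) ^ (1 / 2 : ℂ) = (Real.sqrt (2 * Real.pi / β) : ℂ) := by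
    rw [Real.sqrt_eq_rpow, Complex.ofReal_cpow (by positivity)]
    push_cast
    congr 1
    have : (β : ℂ) ≠ 0 := by exact_mod_cast hβ.ne'
    field_simp
  rw [h5] at h
  have h6 : ∀ ρ : ℝ, (Real.exp (-β * ρ ^ 2 / 2) : ℂ) *
      Complex.exp (-((c : ℂ) + ρ * Complex.I) * t) = Complex.exp (-c * t) *
      (Complex.exp (I * (-t) * ρ) * Complex.exp (-(β / 2 : ℂ) * ρ ^ 2)) := by
    intro ρ
    push_cast
    rw [← Complex.exp_add, ← Complex.exp_add, ← Complex.exp_add]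
    congr 1
    ring
  simp_rw [h6]
  rw [integral_const_mul, h]
  push_cast
  rw [mul_left_comm, ← Complex.exp_add]
  congr 2
  have : (β : ℂ) ≠ 0 := by exact_mod_cast hβ.ne'
  field_simp
  ring

lemma gcc_integrable (β c : ℝ) (hβ : 0 < β) (hc : 0 < c) :
    Integrable (Function.uncurry fun (ρ t : ℝ) => (Real.exp (-β * ρ ^ 2 / 2) : ℂ) *
      Complex.exp (-((c : ℂ) + ρ * Complex.I) * t))
      (volume.prod (volume.restrict (Set.Ioi 0))) := by
  have hg : Integrable (fun ρ : ℝ => Real.exp (-(β / 2) * ρ ^ 2)) :=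
    integrable_exp_neg_mul_sq (by positivity)
  have he : Integrable (fun t : ℝ => Real.exp (-c * t)) (volume.restrict (Set.Ioi 0)) :=
    integrableOn_exp_mul_Ioi (by linarith) 0
  refine (hg.mul_prod he).mono' ?_ ?_
  · apply Continuous.aestronglyMeasurable
    unfold Function.uncurry
    fun_prop
  · refine Filter.Eventually.of_forall fun z => ?_
    simp only [Function.uncurry]
    rw [norm_mul, Complex.norm_exp, Complex.norm_real, Real.norm_of_nonneg (Real.exp_pos _).le]
    apply le_of_eq
    congr 2
    · ring
    · simp

/-- For `β > 0` and `c > 0`, the complex integral `∫ exp(-βρ²/2)/(c + iρ) dρ`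
equals the real number `2π exp(c²β/2) Q(c√β)`. -/
theorem gaussian_complex_cauchy_integral (β c : ℝ) (hβ : 0 < β) (hc : 0 < c) :
    ∫ ρ : ℝ, (Real.exp (-β * ρ ^ 2 / 2) : ℂ) / ((c : ℂ) + ρ * Complex.I) =
      ((2 * Real.pi * Real.exp (c ^ 2 * β / 2) * gaussianQ (c * Real.sqrt β) : ℝ) : ℂ) := by
  have h1 : ∀ ρ : ℝ, (Real.exp (-β * ρ ^ 2 / 2) : ℂ) / ((c : ℂ) + ρ * Complex.I) =
      ∫ t in Set.Ioi (0:ℝ), (Real.exp (-β * ρ ^ 2 / 2) : ℂ) *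
        Complex.exp (-((c : ℂ) + ρ * Complex.I) * t) := by
    intro ρ
    rw [integral_const_mul, integral_exp_mul_complex_Ioi (by simpa using hc)]
    simp only [ofReal_zero, mul_zero, Complex.exp_zero, neg_div_neg_eq]
    rw [mul_one_div]
  simp_rw [h1]
  rw [integral_integral_swap (gcc_integrable β c hβ hc)]
  simp_rw [gcc_inner β c hβ]
  rw [integral_complex_ofReal, integral_const_mul]
  congr 1
  have hs : 0 < Real.sqrt β := Real.sqrt_pos.2 hβ
  have h2 := gcc_real (Real.sqrt β) c hs
  rw [Real.sq_sqrt hβ.le] at h2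
  rw [h2, gaussianQ, integral_const_mul, Real.sqrt_div (by positivity)]
  have h3 : Real.sqrt (2 * Real.pi) ^ 2 = 2 * Real.pi := Real.sq_sqrt (by positivity)
  have h4 : 0 < Real.sqrt (2 * Real.pi) := Real.sqrt_pos.2 (by positivity)
  generalize (∫ u in Set.Ioi (c * Real.sqrt β), Real.exp (-u ^ 2 / 2)) = J
  generalize Real.sqrt (2 * Real.pi) = w at *
  rw [← h3]
  field_simp
end

section
/- For every β > 0 and t₀ ∈ (0,1), the complex-valued integral ∫_{ℝ} exp(−β ρ²/2) · [ 1/(t₀ + iρ) + 1/(1 − t₀ − iρ) ] dρ equals the real number 2π·[ exp(β t₀²/2)·Q(t₀√β) + exp(β(1−t₀)²/2)·Q((1−t₀)√β) ], and this real number is at most √(2π) / ( √β · t₀ · (1 − t₀) ). -/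
open Real Set MeasureTheory Complex

lemma Q_eq (r c : ℝ) (hr : 0 < r) :
    2 * Real.pi * (Real.exp (r ^ 2 * c ^ 2 / 2) * gaussianQ (c * r)) =
      Real.sqrt (2 * Real.pi) / r *
        ∫ s in Set.Ioi (0 : ℝ), Real.exp (-c * s) * Real.exp (-s ^ 2 / (2 * r ^ 2)) := by
  have h1 := integral_comp_mul_left_Ioi
    (fun u : ℝ => Real.exp (-(u + c * r) ^ 2 / 2)) 0 (inv_pos.2 hr)
  have h2 := (measurePreserving_add_right volume (c * r)).setIntegral_preimage_emb
    (measurableEmbedding_addRight (c * r)) (fun u : ℝ => Real.exp (-u ^ 2 / 2)) (Set.Ioi (c * r))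
  have h3 : (fun x : ℝ => x + c * r) ⁻¹' Set.Ioi (c * r) = Set.Ioi 0 := by
    ext x; simp
  rw [h3] at h2
  rw [mul_zero, h2] at h1
  have hg : gaussianQ (c * r) = (1 / Real.sqrt (2 * Real.pi)) *
      ∫ u in Set.Ioi (c * r), Real.exp (-u ^ 2 / 2) := by
    unfold gaussianQ
    rw [integral_const_mul]
  have h4 : ∀ s : ℝ, Real.exp (-c * s) * Real.exp (-s ^ 2 / (2 * r ^ 2)) =
      Real.exp (r ^ 2 * c ^ 2 / 2) * Real.exp (-(r⁻¹ * s + c * r) ^ 2 / 2) := by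
    intro s
    rw [← Real.exp_add, ← Real.exp_add]
    congr 1
    field_simp
    ring
  simp_rw [h4]
  rw [integral_const_mul, h1, hg]
  have hp : Real.sqrt (2 * Real.pi) * Real.sqrt (2 * Real.pi) = 2 * Real.pi :=
    Real.mul_self_sqrt (by positivity)
  have hp0 : 0 < Real.sqrt (2 * Real.pi) := by positivity
  simp only [inv_inv, smul_eq_mul]
  generalize (∫ u in Set.Ioi (c * r), Real.exp (-u ^ 2 / 2)) = X
  field_simp
  linear_combination (-X) * hp

lemma J_le (r c : ℝ) (hr : 0 < r) (hc : 0 < c) :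
    ∫ s in Set.Ioi (0 : ℝ), Real.exp (-c * s) * Real.exp (-s ^ 2 / (2 * r ^ 2)) ≤ 1 / c := by
  have hi := integrableOn_exp_mul_Ioi (a := -c) (by linarith) 0
  have h := integral_exp_mul_Ioi (a := -c) (by linarith) 0
  have h' : 1 / c = ∫ s in Set.Ioi (0 : ℝ), Real.exp (-c * s) := by
    rw [h]; simp
  rw [h']
  apply integral_mono_of_nonneg
  · exact Filter.Eventually.of_forall fun s => by positivity
  · exact hi
  · refine Filter.Eventually.of_forall fun s => ?_
    have : Real.exp (-s ^ 2 / (2 * r ^ 2)) ≤ 1 := by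
      rw [Real.exp_le_one_iff, neg_div]
      have : 0 ≤ s ^ 2 / (2 * r ^ 2) := by positivity
      linarith
    exact mul_le_of_le_one_right (by positivity) this

lemma gauss_int (r : ℝ) (hr : 0 < r) :
    Integrable (fun ρ : ℝ => (Real.exp (-(r ^ 2) * ρ ^ 2 / 2) : ℂ)) := by
  have := (integrable_exp_neg_mul_sq (b := r ^ 2 / 2) (by positivity)).ofReal (𝕜 := ℂ)
  refine this.congr (Filter.Eventually.of_forall fun ρ => ?_)
  simp only [Complex.coe_algebraMap]
  congr 2
  ring

lemma key_int (r c : ℝ) (hr : 0 < r) (hc : 0 < c) :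
    Integrable (fun ρ : ℝ => (Real.exp (-(r ^ 2) * ρ ^ 2 / 2) : ℂ) *
      (1 / ((c : ℂ) + ρ * Complex.I))) := by
  have hne : ∀ ρ : ℝ, (c : ℂ) + ρ * Complex.I ≠ 0 := fun ρ h => by
    have := congrArg Complex.re h
    simp at this
    linarith
  refine (gauss_int r hr).mul_bdd (c := 1 / c) ?_ ?_
  · apply Continuous.aestronglyMeasurable
    exact continuous_const.div (by fun_prop) hne
  · refine Filter.Eventually.of_forall fun ρ => ?_
    rw [norm_div, norm_one]
    apply one_div_le_one_div_of_le hc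
    have := Complex.re_le_norm ((c : ℂ) + ρ * Complex.I)
    simpa using this

lemma key_eq (r c : ℝ) (hr : 0 < r) (hc : 0 < c) :
    ∫ ρ : ℝ, (Real.exp (-(r ^ 2) * ρ ^ 2 / 2) : ℂ) * (1 / ((c : ℂ) + ρ * Complex.I)) =
      ((2 * Real.pi * (Real.exp (r ^ 2 * c ^ 2 / 2) * gaussianQ (c * r)) : ℝ) : ℂ) := by
  have h1 : ∀ ρ : ℝ, (Real.exp (-(r ^ 2) * ρ ^ 2 / 2) : ℂ) * (1 / ((c : ℂ) + ρ * Complex.I)) =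
      ∫ s in Set.Ioi (0 : ℝ), (Real.exp (-(r ^ 2) * ρ ^ 2 / 2) : ℂ) *
        Complex.exp (-((c : ℂ) + ρ * Complex.I) * s) := by
    intro ρ
    rw [integral_const_mul, integral_exp_mul_complex_Ioi (by simpa using hc)]
    congr 1
    rw [Complex.ofReal_zero, mul_zero, Complex.exp_zero, neg_div_neg_eq]
  simp_rw [h1]
  rw [integral_integral_swap]
  · have h2 : ∀ s : ℝ, ∫ ρ : ℝ, (Real.exp (-(r ^ 2) * ρ ^ 2 / 2) : ℂ) *
        Complex.exp (-((c : ℂ) + ρ * Complex.I) * s) =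
        ((Real.sqrt (2 * Real.pi) / r * (Real.exp (-c * s) * Real.exp (-s ^ 2 / (2 * r ^ 2))) : ℝ) : ℂ) := by
      intro s
      have hb : 0 < ((r : ℂ) ^ 2 / 2).re := by
        have : ((r : ℂ) ^ 2 / 2) = ((r ^ 2 / 2 : ℝ) : ℂ) := by push_cast; rfl
        rw [this, Complex.ofReal_re]; positivity
      have hf := fourierIntegral_gaussian hb (-(s : ℂ))
      have h3 : ∀ ρ : ℝ, (Real.exp (-(r ^ 2) * ρ ^ 2 / 2) : ℂ) *
        Complex.exp (-((c : ℂ) + ρ * Complex.I) * s) = Complex.exp (-c * s) *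
          (Complex.exp (Complex.I * (-(s : ℂ)) * ρ) * Complex.exp (-((r : ℂ) ^ 2 / 2) * ρ ^ 2)) := by
        intro ρ
        push_cast
        rw [← Complex.exp_add, ← Complex.exp_add, ← Complex.exp_add]
        congr 1
        ring
      simp_rw [h3]
      rw [integral_const_mul, hf]
      have h4 : ((Real.pi : ℂ) / ((r : ℂ) ^ 2 / 2)) ^ (1 / 2 : ℂ) =
          ((Real.sqrt (2 * Real.pi) / r : ℝ) : ℂ) := by
        have e : Real.sqrt (2 * Real.pi) / r = (Real.pi / (r ^ 2 / 2)) ^ (1 / 2 : ℝ) := by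
          rw [← Real.sqrt_eq_rpow]
          have : Real.pi / (r ^ 2 / 2) = 2 * Real.pi / r ^ 2 := by field_simp
          rw [this, Real.sqrt_div (by positivity), Real.sqrt_sq hr.le]
        rw [e, Complex.ofReal_cpow (by positivity)]
        push_cast
        rfl
      rw [h4]
      push_cast
      have h5 : -(-(s : ℂ)) ^ 2 / (4 * ((r : ℂ) ^ 2 / 2)) = -(s : ℂ) ^ 2 / (2 * (r : ℂ) ^ 2) := by
        congr 1 <;> ring
      rw [h5]
      ring
    simp_rw [h2]
    rw [Q_eq r c hr, integral_complex_ofReal, integral_const_mul]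
  · have hA := (gauss_int r hr).mul_prod
      ((integrableOn_exp_mul_Ioi (a := -c) (by linarith) 0).ofReal (𝕜 := ℂ))
    refine hA.mono ?_ ?_
    · apply Continuous.aestronglyMeasurable
      unfold Function.uncurry
      fun_prop
    · refine Filter.Eventually.of_forall fun z => ?_
      simp only [Function.uncurry, norm_mul]
      gcongr
      simp [Complex.norm_exp]

/-- **Steps (34)–(40) in Appendix A.** For `β > 0` and `t₀ ∈ (0,1)`,
`∫ exp(-βρ²/2) [1/(t₀+iρ) + 1/(1-t₀-iρ)] dρ
  = 2π [exp(βt₀²/2) Q(t₀√β) + exp(β(1-t₀)²/2) Q((1-t₀)√β)]`,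
and this real number is at most `√(2π)/(√β t₀ (1-t₀))`. -/
theorem bromwich_gaussian_bound (β t₀ : ℝ) (hβ : 0 < β) (ht₀ : t₀ ∈ Set.Ioo (0 : ℝ) 1) :
    (∫ ρ : ℝ, (Real.exp (-β * ρ ^ 2 / 2) : ℂ) *
        (1 / ((t₀ : ℂ) + ρ * Complex.I) + 1 / (1 - (t₀ : ℂ) - ρ * Complex.I)) =
      ((2 * Real.pi * (Real.exp (β * t₀ ^ 2 / 2) * gaussianQ (t₀ * Real.sqrt β) +
          Real.exp (β * (1 - t₀) ^ 2 / 2) * gaussianQ ((1 - t₀) * Real.sqrt β)) : ℝ) : ℂ))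
    ∧ 2 * Real.pi * (Real.exp (β * t₀ ^ 2 / 2) * gaussianQ (t₀ * Real.sqrt β) +
          Real.exp (β * (1 - t₀) ^ 2 / 2) * gaussianQ ((1 - t₀) * Real.sqrt β)) ≤
        Real.sqrt (2 * Real.pi) / (Real.sqrt β * t₀ * (1 - t₀)) := by
  obtain ⟨h0, h1⟩ := ht₀
  have hc1 : 0 < 1 - t₀ := by linarith
  have hr : 0 < Real.sqrt β := Real.sqrt_pos.2 hβ
  have hsq : Real.sqrt β ^ 2 = β := Real.sq_sqrt hβ.le
  generalize Real.sqrt β = r at hr hsq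
  subst hsq
  constructor
  · have e : ∀ ρ : ℝ, (Real.exp (-(r ^ 2) * ρ ^ 2 / 2) : ℂ) *
        (1 / ((t₀ : ℂ) + ρ * Complex.I) + 1 / (1 - (t₀ : ℂ) - ρ * Complex.I)) =
        (Real.exp (-(r ^ 2) * ρ ^ 2 / 2) : ℂ) * (1 / ((t₀ : ℂ) + ρ * Complex.I)) +
        (Real.exp (-(r ^ 2) * (-ρ) ^ 2 / 2) : ℂ) *
          (1 / (((1 - t₀ : ℝ) : ℂ) + ((-ρ : ℝ) : ℂ) * Complex.I)) := by
      intro ρ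
      rw [neg_sq, mul_add]
      congr 3
      push_cast
      ring
    simp_rw [e]
    rw [integral_add (key_int r t₀ hr h0) (key_int r (1 - t₀) hr hc1).comp_neg,
      integral_neg_eq_self (fun ρ : ℝ => (Real.exp (-(r ^ 2) * ρ ^ 2 / 2) : ℂ) *
          (1 / (((1 - t₀ : ℝ) : ℂ) + (ρ : ℂ) * Complex.I))) volume,
      key_eq r t₀ hr h0, key_eq r (1 - t₀) hr hc1, ← Complex.ofReal_add, ← mul_add]
  · rw [mul_add, Q_eq r t₀ hr, Q_eq r (1 - t₀) hr, ← mul_add]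
    have := add_le_add (J_le r t₀ hr h0) (J_le r (1 - t₀) hr hc1)
    refine (mul_le_mul_of_nonneg_left this (by positivity)).trans (le_of_eq ?_)
    field_simp
    ring
end

section
/- Fix σ > 0. Let X and Z be independent real Gaussian random variables with mean 0 and variances σ² and 1 respectively, and set Y = X + Z. Define ι := log( φ_1(Y − X) / φ_{1+σ²}(Y) ), where φ_v(x) = (2πv)^(−1/2) exp(−x²/(2v)) is the density of the centered Gaussian with variance v. Then for every real t with t² < (1 + σ²)/σ², the expectation E[exp(t·ι)] is finite and equals (1 + σ²)^{t/2} · (1 − σ² t²/(1 + σ²))^(−1/2). -/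
open Real Set MeasureTheory ProbabilityTheory

/-- The density `φ_v(x) = (2πv)^(-1/2) exp(-x²/(2v))` of the centered Gaussian with
variance `v`. -/
noncomputable def gpdf (v x : ℝ) : ℝ :=
  (2 * Real.pi * v) ^ (-(1/2) : ℝ) * Real.exp (-x ^ 2 / (2 * v))

lemma lint_gauss (v : ℝ) (hv : 0 < v) (b c : ℝ) (hD : 0 < 1 - 2 * v * c) :
    ∫⁻ x, ENNReal.ofReal (Real.exp (c * x ^ 2 + b * x)) ∂(gaussianReal 0 (Real.toNNReal v)) =
      ENNReal.ofReal ((√(1 - 2 * v * c))⁻¹ * Real.exp (v * b ^ 2 / (2 * (1 - 2 * v * c)))) := by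
  set D := 1 - 2 * v * c with hDdef
  have hv' : 0 < v / D := by positivity
  have h1 : Real.toNNReal v ≠ 0 := by simpa using hv
  have h2 : Real.toNNReal (v / D) ≠ 0 := by simpa using hv'
  have hc : c = (1 - D) / (2 * v) := by rw [hDdef]; field_simp; ring
  rw [gaussianReal_of_var_ne_zero _ h1,
    lintegral_withDensity_eq_lintegral_mul _ (measurable_gaussianPDF _ _) (by fun_prop)]
  have key : ∀ x, (gaussianPDF 0 (Real.toNNReal v) *
      fun x => ENNReal.ofReal (Real.exp (c * x ^ 2 + b * x))) x =
      ENNReal.ofReal ((√D)⁻¹ * Real.exp (v * b ^ 2 / (2 * D))) *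
        gaussianPDF (v / D * b) (Real.toNNReal (v / D)) x := by
    intro x
    simp only [Pi.mul_apply, gaussianPDF]
    rw [← ENNReal.ofReal_mul (gaussianPDFReal_nonneg _ _ _),
      ← ENNReal.ofReal_mul (by positivity)]
    congr 1
    simp only [gaussianPDFReal, Real.coe_toNNReal _ hv.le, Real.coe_toNNReal _ hv'.le]
    have e1 : √(2 * π * (v / D)) = √(2 * π * v) / √D := by
      rw [← mul_div_assoc, Real.sqrt_div (by positivity)]
    have hs : √D ≠ 0 := (Real.sqrt_pos.2 hD).ne'
    have hs2 : √(2 * π * v) ≠ 0 := (Real.sqrt_pos.2 (by positivity)).ne'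
    have e2 : -(x - 0) ^ 2 / (2 * v) + (c * x ^ 2 + b * x) =
        v * b ^ 2 / (2 * D) + -(x - v / D * b) ^ 2 / (2 * (v / D)) := by
      rw [hc]; field_simp; ring
    rw [mul_assoc, ← Real.exp_add, e2, Real.exp_add, e1]
    field_simp
  rw [lintegral_congr key, lintegral_const_mul _ (measurable_gaussianPDF _ _),
    lintegral_gaussianPDF_eq_one _ h2, mul_one]

/-- **Per-channel-use MGF (31), Appendix A.** For independent `X ~ N(0,σ²)` and
`Z ~ N(0,1)`, `Y = X + Z`, and the information density
`ι = log(φ₁(Y-X)/φ_{1+σ²}(Y))`, one has, for every `t` with `t² < (1+σ²)/σ²`,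
`𝔼[exp(tι)] = (1+σ²)^{t/2} (1 - σ²t²/(1+σ²))^{-1/2}` (in particular it is finite). -/
theorem mgf_information_density_single
    {Ω : Type*} [MeasurableSpace Ω] (μ : Measure Ω) [IsProbabilityMeasure μ]
    (σ : ℝ) (hσ : 0 < σ) (X Z : Ω → ℝ)
    (hXm : Measurable X) (hZm : Measurable Z)
    (hindep : IndepFun X Z μ)
    (hX : μ.map X = gaussianReal 0 (Real.toNNReal (σ ^ 2)))
    (hZ : μ.map Z = gaussianReal 0 1)
    (t : ℝ) (ht : t ^ 2 < (1 + σ ^ 2) / σ ^ 2) :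
    Integrable (fun ω => Real.exp (t *
        Real.log (gpdf 1 ((X ω + Z ω) - X ω) / gpdf (1 + σ ^ 2) (X ω + Z ω)))) μ
    ∧ ∫ ω, Real.exp (t *
        Real.log (gpdf 1 ((X ω + Z ω) - X ω) / gpdf (1 + σ ^ 2) (X ω + Z ω))) ∂μ =
      (1 + σ ^ 2) ^ (t / 2) * (1 - σ ^ 2 * t ^ 2 / (1 + σ ^ 2)) ^ (-(1/2) : ℝ) := by
  obtain ⟨s, hs⟩ : ∃ s, s = σ ^ 2 := ⟨_, rfl⟩
  have hs0 : 0 < s := by rw [hs]; positivity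
  simp only [← hs] at *
  have ht' : s * t ^ 2 < 1 + s := by
    rw [lt_div_iff₀ hs0] at ht; linarith
  have hA : 0 < 1 + s + t * s := by
    by_contra! h
    nlinarith [sq_nonneg (t * s + (1 + s)), sq_nonneg (t * s)]
  have hA2 : 1 + s + s * t ≠ 0 := by rw [mul_comm s t]; exact hA.ne'
  have hA3 : 1 + s * (1 + t) ≠ 0 := by intro h; apply hA2; linarith
  have hE : ∀ ω, Real.exp (t * Real.log (gpdf 1 ((X ω + Z ω) - X ω) / gpdf (1 + s) (X ω + Z ω)))
      = (1 + s) ^ (t / 2) *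
        Real.exp (t * ((X ω + Z ω) ^ 2 / (2 * (1 + s)) - Z ω ^ 2 / 2)) := by
    intro ω
    have p1 : (0:ℝ) < 2 * π := by positivity
    have p2 : (0:ℝ) < 1 + s := by positivity
    rw [Real.rpow_def_of_pos p2, ← Real.exp_add]
    congr 1
    unfold gpdf
    rw [Real.log_div (by positivity) (by positivity), Real.log_mul (by positivity) (by positivity),
      Real.log_mul (by positivity) (by positivity), Real.log_exp, Real.log_exp,
      Real.log_rpow (by positivity), Real.log_rpow (by positivity),
      Real.log_mul p1.ne' p2.ne', mul_one]
    ring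
  simp only [hE]
  set g : ℝ × ℝ → ℝ := fun p =>
    Real.exp (t * ((p.1 + p.2) ^ 2 / (2 * (1 + s)) - p.2 ^ 2 / 2)) with hg
  have hgm : Measurable g := by fun_prop
  have hmap : μ.map (fun ω => (X ω, Z ω)) =
      (gaussianReal 0 (Real.toNNReal s)).prod (gaussianReal 0 1) := by
    rw [← hX, ← hZ]
    exact (indepFun_iff_map_prod_eq_prod_map_map hXm.aemeasurable hZm.aemeasurable).1 hindep
  have hl : ∫⁻ ω, ENNReal.ofReal (g (X ω, Z ω)) ∂μ =
      ENNReal.ofReal ((√(1 - s * t ^ 2 / (1 + s)))⁻¹) := by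
    rw [← lintegral_map (f := fun p => ENNReal.ofReal (g p)) (g := fun ω => (X ω, Z ω))
      (by fun_prop) (by fun_prop), hmap, lintegral_prod _ (by fun_prop)]
    have hD1 : 1 - 2 * 1 * (-(t * s) / (2 * (1 + s))) = (1 + s + t * s) / (1 + s) := by
      field_simp; ring
    have hD2 : 1 - 2 * s * (t * (1 + t) / (2 * (1 + s + t * s))) =
        (1 + s - s * t ^ 2) / (1 + s + t * s) := by
      field_simp; ring
    have hn : 0 < 1 + s - s * t ^ 2 := by linarith
    have inner : ∀ x, ∫⁻ z, ENNReal.ofReal (g (x, z)) ∂(gaussianReal 0 1) =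
        ENNReal.ofReal ((√((1 + s + t * s) / (1 + s)))⁻¹) *
        ENNReal.ofReal (Real.exp (t * (1 + t) / (2 * (1 + s + t * s)) * x ^ 2 + 0 * x)) := by
      intro x
      have := lint_gauss 1 one_pos (t * x / (1 + s)) (-(t * s) / (2 * (1 + s)))
        (by rw [hD1]; positivity)
      rw [hD1, Real.toNNReal_one] at this
      have e : ∀ z, ENNReal.ofReal (g (x, z)) =
          ENNReal.ofReal (Real.exp (t * x ^ 2 / (2 * (1 + s)))) *
          ENNReal.ofReal (Real.exp (-(t * s) / (2 * (1 + s)) * z ^ 2 + t * x / (1 + s) * z)) := by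
        intro z
        rw [← ENNReal.ofReal_mul (by positivity), ← Real.exp_add, hg]
        congr 2
        field_simp
        ring
      rw [lintegral_congr e, lintegral_const_mul _ (by fun_prop), this,
        ← ENNReal.ofReal_mul (by positivity), ← ENNReal.ofReal_mul (by positivity),
        mul_left_comm, ← Real.exp_add]
      congr 3
      field_simp
      ring
    rw [lintegral_congr inner, lintegral_const_mul _ (by fun_prop),
      lint_gauss s hs0 _ _ (by rw [hD2]; positivity), hD2, ← ENNReal.ofReal_mul (by positivity)]
    congr 1
    have : 1 - s * t ^ 2 / (1 + s) =
        (1 + s + t * s) / (1 + s) * ((1 + s - s * t ^ 2) / (1 + s + t * s)) := by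
      field_simp
    rw [this, Real.sqrt_mul (by positivity), mul_inv]
    simp
  have hint : Integrable (fun ω => g (X ω, Z ω)) μ := by
    refine ⟨by fun_prop, ?_⟩
    rw [hasFiniteIntegral_iff_ofReal (ae_of_all _ fun ω => (Real.exp_pos _).le), hl]
    exact ENNReal.ofReal_lt_top
  refine ⟨hint.const_mul _, ?_⟩
  rw [integral_const_mul]
  congr 1
  change ∫ ω, g (X ω, Z ω) ∂μ = _
  rw [integral_eq_lintegral_of_nonneg_ae (ae_of_all _ fun ω => (Real.exp_pos _).le)
    hint.aestronglyMeasurable, hl, ENNReal.toReal_ofReal (by positivity)]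
  have hq : 0 ≤ 1 - s * t ^ 2 / (1 + s) := by
    rw [sub_nonneg, div_le_one (by positivity)]; exact ht'.le
  rw [Real.rpow_neg hq, Real.sqrt_eq_rpow]
end

section
/- Fix σ > 0. Let X and Z be independent real Gaussian random variables with mean 0 and variances σ² and 1 respectively, set Y = X + Z, and define ι := log( φ_1(Y − X) / φ_{1+σ²}(Y) ), where φ_v(x) = (2πv)^(−1/2) exp(−x²/(2v)). Then for every real t with t ≥ √((1 + σ²)/σ²), the expectation E[exp(t·ι)] is infinite (the defining integral diverges). -/
open Real Set MeasureTheory ProbabilityTheory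

theorem gpdf_log_ratio (v x z : ℝ) (hv : 0 < v) :
    Real.log (gpdf 1 z / gpdf v x) =
      Real.log ((2 * Real.pi * 1) ^ (-(1/2) : ℝ) / (2 * Real.pi * v) ^ (-(1/2) : ℝ))
        + (x ^ 2 / (2 * v) - z ^ 2 / 2) := by
  have h1 : (0:ℝ) < (2 * Real.pi * 1) ^ (-(1/2) : ℝ) := by positivity
  have h2 : (0:ℝ) < (2 * Real.pi * v) ^ (-(1/2) : ℝ) := by positivity
  unfold gpdf
  rw [mul_div_mul_comm, Real.log_mul (by positivity) (by positivity), ← Real.exp_sub, Real.log_exp]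
  ring

theorem quad_lower (s t x z : ℝ) (hs : 0 < s) (ht0 : 0 < t) (ht : (1 + s) / s ≤ t ^ 2)
    (hz : (z - (t / (1 + s)) * x / (t * s / (1 + s) + 1)) ^ 2 ≤ 1) :
    -(t * s / (1 + s) + 1) / 2 ≤
      t * ((x + z) ^ 2 / (2 * (1 + s)) - z ^ 2 / 2) - x ^ 2 / (2 * s) - z ^ 2 / 2 := by
  set D := t * s / (1 + s) + 1 with hD
  have hDpos : 0 < D := by positivity
  have hts : 0 ≤ t ^ 2 / (1 + s) - 1 / s := by
    rw [div_le_iff₀ hs] at ht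
    rw [sub_nonneg, div_le_div_iff₀ hs (by positivity)]
    linarith
  have key : t * ((x + z) ^ 2 / (2 * (1 + s)) - z ^ 2 / 2) - x ^ 2 / (2 * s) - z ^ 2 / 2
      = -D / 2 * (z - (t / (1 + s)) * x / D) ^ 2 + (t ^ 2 / (1 + s) - 1 / s) / D * x ^ 2 / 2 := by
    have hne : t * s + (1 + s) ≠ 0 := by positivity
    have hD' : D = (t * s + (1 + s)) / (1 + s) := by rw [hD]; field_simp
    rw [hD']
    field_simp
    ring
  rw [key]
  have h1 : 0 ≤ (t ^ 2 / (1 + s) - 1 / s) / D * x ^ 2 / 2 := by positivity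
  nlinarith

theorem mgf_information_density_diverges
    {Ω : Type*} [MeasurableSpace Ω] (μ : Measure Ω) [IsProbabilityMeasure μ]
    (σ : ℝ) (hσ : 0 < σ) (X Z : Ω → ℝ)
    (hXm : Measurable X) (hZm : Measurable Z)
    (hindep : IndepFun X Z μ)
    (hX : μ.map X = gaussianReal 0 (Real.toNNReal (σ ^ 2)))
    (hZ : μ.map Z = gaussianReal 0 1)
    (t : ℝ) (ht : Real.sqrt ((1 + σ ^ 2) / σ ^ 2) ≤ t) :
    ∫⁻ ω, ENNReal.ofReal (Real.exp (t *
        Real.log (gpdf 1 ((X ω + Z ω) - X ω) / gpdf (1 + σ ^ 2) (X ω + Z ω)))) ∂μ = ⊤ := by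
  have hs : 0 < σ ^ 2 := by positivity
  have ht0 : 0 < t := lt_of_lt_of_le (Real.sqrt_pos.2 (by positivity)) ht
  have ht2 : (1 + σ ^ 2) / σ ^ 2 ≤ t ^ 2 := (Real.sqrt_le_left ht0.le).1 ht
  set s := σ ^ 2 with hsdef
  set L := Real.log ((2 * Real.pi * 1) ^ (-(1/2) : ℝ) / (2 * Real.pi * (1 + s)) ^ (-(1/2) : ℝ))
    with hL
  set f : ℝ × ℝ → ENNReal := fun p => ENNReal.ofReal (Real.exp (t *
    (L + ((p.1 + p.2) ^ 2 / (2 * (1 + s)) - p.2 ^ 2 / 2)))) with hf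
  have hfm : Measurable f := by rw [hf]; fun_prop
  have hv0 : Real.toNNReal s ≠ 0 := by simpa using hs
  have e1 : ∫⁻ ω, ENNReal.ofReal (Real.exp (t *
        Real.log (gpdf 1 ((X ω + Z ω) - X ω) / gpdf (1 + s) (X ω + Z ω)))) ∂μ
      = ∫⁻ ω, f (X ω, Z ω) ∂μ := by
    refine lintegral_congr fun ω => ?_
    rw [gpdf_log_ratio _ _ _ (by positivity), add_sub_cancel_left]
  rw [e1, ← lintegral_map (μ := μ) (g := fun ω => (X ω, Z ω)) hfm (hXm.prodMk hZm),
    (indepFun_iff_map_prod_eq_prod_map_map hXm.aemeasurable hZm.aemeasurable).1 hindep, hX, hZ,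
    lintegral_prod _ hfm.aemeasurable, gaussianReal_of_var_ne_zero _ hv0,
    gaussianReal_of_var_ne_zero _ one_ne_zero,
    lintegral_withDensity_eq_lintegral_mul _ (measurable_gaussianPDF _ _)
      (Measurable.lintegral_prod_right' hfm)]
  set D := t * s / (1 + s) + 1 with hD
  set K := (√(2 * π * s))⁻¹ * (√(2 * π))⁻¹ * Real.exp (t * L) * Real.exp (-D / 2) with hK
  have hKpos : 0 < K := by positivity
  rw [eq_top_iff]
  calc (⊤ : ENNReal) = ∫⁻ x : ℝ, ENNReal.ofReal K := by
        rw [lintegral_const, Real.volume_univ, ENNReal.mul_top]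
        simpa using hKpos
    _ ≤ _ := by
        refine lintegral_mono fun x => ?_
        simp only [Pi.mul_apply]
        have hfx : Measurable fun z => f (x, z) := hfm.comp measurable_prodMk_left
        rw [lintegral_withDensity_eq_lintegral_mul _ (measurable_gaussianPDF _ _) hfx,
          ← lintegral_const_mul _ ((measurable_gaussianPDF _ _).mul hfx)]
        set c := (t / (1 + s)) * x / D with hc
        calc ENNReal.ofReal K = ∫⁻ z in Icc c (c + 1), ENNReal.ofReal K := by
              simp
          _ ≤ ∫⁻ z in Icc c (c + 1), gaussianPDF 0 s.toNNReal x *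
                ((gaussianPDF 0 1 * fun z => f (x, z)) z) := by
              refine setLIntegral_mono' measurableSet_Icc fun z hz => ?_
              have hz' : (z - c) ^ 2 ≤ 1 := by nlinarith [hz.1, hz.2]
              have hq := quad_lower s t x z hs ht0 ht2 hz'
              simp only [Pi.mul_apply, hf, gaussianPDF]
              rw [← ENNReal.ofReal_mul (gaussianPDFReal_nonneg _ _ _),
                ← ENNReal.ofReal_mul (gaussianPDFReal_nonneg _ _ _)]
              refine ENNReal.ofReal_le_ofReal ?_
              have e : gaussianPDFReal 0 s.toNNReal x * (gaussianPDFReal 0 1 z *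
                  Real.exp (t * (L + ((x + z) ^ 2 / (2 * (1 + s)) - z ^ 2 / 2))))
                  = (√(2 * π * s))⁻¹ * (√(2 * π))⁻¹ * Real.exp (t * L) * Real.exp
                    (t * ((x + z) ^ 2 / (2 * (1 + s)) - z ^ 2 / 2) - x ^ 2 / (2 * s) - z ^ 2 / 2) := by
                simp only [gaussianPDFReal, Real.coe_toNNReal s hs.le, NNReal.coe_one, mul_one,
                  sub_zero]
                generalize (x + z) ^ 2 / (2 * (1 + s)) - z ^ 2 / 2 = w
                rw [mul_add t, Real.exp_add,
                  show t * w - x ^ 2 / (2 * s) - z ^ 2 / 2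
                    = t * w + (-x ^ 2 / (2 * s)) + (-z ^ 2 / 2) by ring,
                  Real.exp_add, Real.exp_add]
                ring
              rw [e, hK]
              gcongr
          _ ≤ _ := setLIntegral_le_lintegral _ _
end

section
/- Fix P > 0, L ∈ ℝ, n ≥ 1, and vectors a = (a_1,…,a_n) and a' = (a'_1,…,a'_n) of nonnegative reals with a'_i ≤ a_i for all i. If t₀ ∈ (0,1) satisfies ∑_{i=1}^n [ (1/2)·log(1 + a_i P) − a_i P t₀ / (1 + a_i P − a_i P t₀²) ] = L, then for every t ∈ (0,1) one has exp(t₀·L − E(a,t₀)) ≤ exp(t·L − E(a',t)). -/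
open Real Set Finset

theorem aux_log (x t : ℝ) (hx : 0 ≤ x) (h0 : 0 < t) (h1 : t < 1) :
    0 < 1 + x - x * t ^ 2 ∧
    Real.log (1 - x * t ^ 2 / (1 + x)) = Real.log (1 + x - x * t ^ 2) - Real.log (1 + x) := by
  have hD : 0 < 1 + x - x * t ^ 2 := by
    have : t ^ 2 ≤ 1 := by nlinarith
    nlinarith
  refine ⟨hD, ?_⟩
  have hx1 : 0 < 1 + x := by linarith
  rw [← Real.log_div hD.ne' hx1.ne']
  congr 1
  field_simp

theorem aux_mono (x y t : ℝ) (hy : 0 ≤ y) (hxy : y ≤ x) (h0 : 0 < t) (h1 : t < 1) :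
    t * Real.log (1 + y) + Real.log (1 - y * t ^ 2 / (1 + y)) ≤
    t * Real.log (1 + x) + Real.log (1 - x * t ^ 2 / (1 + x)) := by
  have hx : 0 ≤ x := hy.trans hxy
  obtain ⟨hDx, ex⟩ := aux_log x t hx h0 h1
  obtain ⟨hDy, ey⟩ := aux_log y t hy h0 h1
  rw [ex, ey]
  have hx1 : 0 < 1 + x := by linarith
  have hy1 : 0 < 1 + y := by linarith
  have hq : 0 < (1 + x) / (1 + y) := by positivity
  have e : 1 + (x - y) / (1 + y) = (1 + x) / (1 + y) := by field_simp; ring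
  have hb := rpow_one_add_le_one_add_mul_self (s := (x - y) / (1 + y))
    (by have : 0 ≤ (x - y) / (1 + y) := div_nonneg (by linarith) hy1.le
        linarith) (p := 1 - t) (by linarith) (by linarith)
  rw [e] at hb
  have hc : 1 + (1 - t) * ((x - y) / (1 + y)) ≤ (1 + x - x * t ^ 2) / (1 + y - y * t ^ 2) := by
    have e2 : (1 + x - x * t ^ 2) / (1 + y - y * t ^ 2)
        - (1 + (1 - t) * ((x - y) / (1 + y)))
        = (1 - t) * (x - y) * (t + y * t + y * t ^ 2) / ((1 + y - y * t ^ 2) * (1 + y)) := by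
      have := hDy.ne'
      generalize hD : 1 + y - y * t ^ 2 = D at this ⊢
      field_simp
      rw [← hD]
      ring
    have : 0 ≤ (1 - t) * (x - y) * (t + y * t + y * t ^ 2) / ((1 + y - y * t ^ 2) * (1 + y)) := by
      have h2 : 0 ≤ 1 - t := by linarith
      have h3 : 0 ≤ x - y := by linarith
      positivity
    linarith
  have hl := Real.log_le_log (Real.rpow_pos_of_pos hq _) (hb.trans hc)
  rw [Real.log_rpow hq, Real.log_div hx1.ne' hy1.ne', Real.log_div hDx.ne' hDy.ne'] at hl
  linarith

theorem aux_conc (x s t : ℝ) (hx : 0 ≤ x) (hs0 : 0 < s) (hs1 : s < 1) (h0 : 0 < t) (h1 : t < 1) :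
    Real.log (1 - x * t ^ 2 / (1 + x)) ≤ Real.log (1 - x * s ^ 2 / (1 + x))
      - 2 * (t - s) * (x * s / (1 + x - x * s ^ 2)) := by
  obtain ⟨hD, e⟩ := aux_log x t hx h0 h1
  obtain ⟨hDs, es⟩ := aux_log x s hx hs0 hs1
  rw [e, es]
  have h := Real.log_le_sub_one_of_pos (div_pos hD hDs)
  rw [Real.log_div hD.ne' hDs.ne'] at h
  have e2 : (1 + x - x * t ^ 2) / (1 + x - x * s ^ 2) - 1
      = - (2 * (t - s) * (x * s / (1 + x - x * s ^ 2)))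
        - x * (t - s) ^ 2 / (1 + x - x * s ^ 2) := by
    have := hDs.ne'
    field_simp
    ring
  have : 0 ≤ x * (t - s) ^ 2 / (1 + x - x * s ^ 2) := by positivity
  linarith

/-- **Inequality (43), Appendix B.** With `g₁(a,t) = exp(tL - E(a,t))`, if `t₀ ∈ (0,1)`
is the stationary point of `g₁(a,·)` and `a' ≤ a` coordinatewise (both nonnegative), then
`g₁(a,t₀) ≤ g₁(a',t)` for every `t ∈ (0,1)`. -/
theorem g1_min_le_g1_smaller_a
    (P L : ℝ) (hP : 0 < P) (n : ℕ) (hn : 1 ≤ n) (a a' : Fin n → ℝ)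
    (ha' : ∀ i, 0 ≤ a' i) (hle : ∀ i, a' i ≤ a i)
    (t₀ : ℝ) (ht₀ : t₀ ∈ Set.Ioo (0 : ℝ) 1)
    (hstat : ∑ i, ((1/2) * Real.log (1 + a i * P) -
        a i * P * t₀ / (1 + a i * P - a i * P * t₀ ^ 2)) = L) :
    ∀ t ∈ Set.Ioo (0 : ℝ) 1,
      Real.exp (t₀ * L - E P a t₀) ≤ Real.exp (t * L - E P a' t) := by
  rintro t ⟨h0, h1⟩
  obtain ⟨hs0, hs1⟩ := ht₀
  apply Real.exp_le_exp.mpr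
  rw [← hstat]
  unfold E
  rw [Finset.mul_sum, Finset.mul_sum, Finset.mul_sum, Finset.mul_sum,
    ← Finset.sum_sub_distrib, ← Finset.sum_sub_distrib]
  apply Finset.sum_le_sum
  intro i _
  have hy : 0 ≤ a' i * P := mul_nonneg (ha' i) hP.le
  have hxy : a' i * P ≤ a i * P := mul_le_mul_of_nonneg_right (hle i) hP.le
  have hm := aux_mono _ _ t hy hxy h0 h1
  have hc := aux_conc _ t₀ t (hy.trans hxy) hs0 hs1 h0 h1
  linarith
end
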